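/- Let Y be a convex subset of the Boolean lattice B_n, let b > 0, and set Z = {y ∈ Y : d⁺_Y(y) < b}, where d⁺_Y(y) is the number of elements of Y covering y. Then Z is convex. -/

import Mathlib

/-- `dplus Y y` is the number of elements of `Y` covering `y` in the Boolean lattice,
i.e. the number of `x ∈ Y` with `y ⊆ x` and `|x| = |y| + 1`. -/
noncomputable def dplus {n : ℕ} (Y : Set (Finset (Fin n))) (y : Finset (Fin n)) : ℕ :=
  {x ∈ Y | y ⊆ x ∧ x.card = y.card + 1}.ncard

/-- In a convex set, going up in the lattice does not increase the number of upper covers. -/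
theorem dplus_anti {n : ℕ} {Y : Set (Finset (Fin n))}
    (hconv : ∀ x y z : Finset (Fin n), x ∈ Y → z ∈ Y → x ⊆ y → y ⊆ z → y ∈ Y)
    {x y : Finset (Fin n)} (hx : x ∈ Y) (hxy : x ⊆ y) : dplus Y y ≤ dplus Y x := by
  refine Set.ncard_le_ncard_of_injOn (fun w => x ∪ (w \ y)) ?_ ?_ (Set.toFinite _)
  · rintro w ⟨hw, hyw, hcard⟩
    refine ⟨hconv x _ w hx hw Finset.subset_union_left
      (Finset.union_subset (hxy.trans hyw) Finset.sdiff_subset),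
      Finset.subset_union_left, ?_⟩
    rw [Finset.card_union_of_disjoint (Finset.disjoint_sdiff.mono_left hxy),
      Finset.card_sdiff_of_subset hyw]
    omega
  · rintro w ⟨-, hyw, -⟩ v ⟨-, hyv, -⟩ h
    have h' : y ∪ (x ∪ (w \ y)) = y ∪ (x ∪ (v \ y)) := congrArg (y ∪ ·) h
    rwa [← Finset.union_assoc, ← Finset.union_assoc, Finset.union_eq_left.2 hxy,
      Finset.union_sdiff_of_subset hyw, Finset.union_sdiff_of_subset hyv] at h'

theorem convex_of_low_updegree_part {n : ℕ} (Y : Set (Finset (Fin n))) (b : ℝ) (hb : 0 < b)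
    (hconv : ∀ x y z : Finset (Fin n), x ∈ Y → z ∈ Y → x ⊆ y → y ⊆ z → y ∈ Y) :
    ∀ x y z : Finset (Fin n),
      x ∈ {y ∈ Y | (dplus Y y : ℝ) < b} → z ∈ {y ∈ Y | (dplus Y y : ℝ) < b} →
      x ⊆ y → y ⊆ z → y ∈ {y ∈ Y | (dplus Y y : ℝ) < b} := by
  rintro x y z ⟨hx, hxb⟩ ⟨hz, -⟩ hxy hyz
  exact ⟨hconv x y z hx hz hxy hyz,
    (Nat.cast_le.2 (dplus_anti hconv hx hxy)).trans_lt hxb⟩
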